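/- Let G = (V,E,w) be a weighted graph on n ≥ 2 vertices, let 1 ≤ q < ∞, and let γ:(0,1]→ℝ≥0 be a function such that x ↦ γ(x)^q is integrable on the interval [ (1/2)·(n choose 2)^{-1}, 1 ]. If a spanner H of G has scaling distortion γ, then dist_q(H,G) ≤ ( 2·∫_{(1/2)(n choose 2)^{-1}}^{1} γ(x)^q dx )^{1/q}. -/

import Mathlib

open Finset

attribute [local instance] Classical.propDecidable

section Defs

variable {V : Type*} [Fintype V]

/-- Total weight of a (sub)graph: the sum of its edge weights. -/
noncomputable def wWeight (H : SimpleGraph V) (w : Sym2 V → ℝ) : ℝ :=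
  ∑ e ∈ H.edgeSet.toFinite.toFinset, w e

/-- Shortest-path distance in a weighted graph: infimum of walk weights. -/
noncomputable def wdist (G : SimpleGraph V) (w : Sym2 V → ℝ) (u v : V) : ℝ :=
  sInf {x : ℝ | ∃ p : G.Walk u v, x = (p.edges.map w).sum}

/-- `T` is a spanning tree of `G`. -/
def IsSpanningTree (G T : SimpleGraph V) : Prop :=
  T ≤ G ∧ T.IsTree

/-- Weight of a minimum spanning tree of `G`. -/
noncomputable def mstWeight (G : SimpleGraph V) (w : Sym2 V → ℝ) : ℝ :=
  sInf {x : ℝ | ∃ T : SimpleGraph V, IsSpanningTree G T ∧ x = wWeight T w}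

/-- `T` is a minimum spanning tree of `G`. -/
def IsMST (G : SimpleGraph V) (w : Sym2 V → ℝ) (T : SimpleGraph V) : Prop :=
  IsSpanningTree G T ∧ ∀ T' : SimpleGraph V, IsSpanningTree G T' → wWeight T w ≤ wWeight T' w

/-- A spanner of `G`: a connected spanning subgraph. -/
def IsSpanner (G H : SimpleGraph V) : Prop := H ≤ G ∧ H.Connected

/-- `G` together with `w` is a weighted graph: connected, positive pairwise-distinct
edge weights. -/
def IsWeightedGraph (G : SimpleGraph V) (w : Sym2 V → ℝ) : Prop :=
  G.Connected ∧ (∀ e ∈ G.edgeSet, 0 < w e) ∧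
    (∀ e ∈ G.edgeSet, ∀ e' ∈ G.edgeSet, e ≠ e' → w e ≠ w e')

/-- The ordered pairs of distinct vertices whose distortion in `H` is at most `t`. -/
noncomputable def goodPairs (G H : SimpleGraph V) (w : Sym2 V → ℝ) (t : ℝ) : Finset (V × V) :=
  Finset.univ.offDiag.filter (fun p => wdist H w p.1 p.2 ≤ t * wdist G w p.1 p.2)

/-- Scaling distortion `γ`: for every `ε ∈ (0,1)`, at least a `(1-ε)` fraction of the
pairs of distinct vertices have distortion at most `γ ε`.  (Counted over ordered pairs:
`n·(n-1) = 2·(n choose 2)`.) -/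
def HasScalingDistortion (G H : SimpleGraph V) (w : Sym2 V → ℝ) (γ : ℝ → ℝ) : Prop :=
  ∀ ε : ℝ, 0 < ε → ε < 1 →
    (1 - ε) * ((Fintype.card V : ℝ) * ((Fintype.card V : ℝ) - 1)) ≤
      ((goodPairs G H w (γ ε)).card : ℝ)

/-- The `ℓ_q`-distortion of the spanner `H` of `G`. -/
noncomputable def distq (G H : SimpleGraph V) (w : Sym2 V → ℝ) (q : ℝ) : ℝ :=
  ((∑ p ∈ (Finset.univ : Finset V).offDiag, (wdist H w p.1 p.2 / wdist G w p.1 p.2) ^ q) /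
    ((Fintype.card V : ℝ) * ((Fintype.card V : ℝ) - 1))) ^ (1 / q)

/-- `R(v,ε)`: the minimal radius `r` such that the ball `B(v,r)` contains at least `εn`
vertices. -/
noncomputable def Rgraph (G : SimpleGraph V) (w : Sym2 V → ℝ) (v : V) (ε : ℝ) : ℝ :=
  sInf {r : ℝ | 0 ≤ r ∧
    ε * (Fintype.card V : ℝ) ≤ ((Finset.univ.filter (fun u => wdist G w u v ≤ r)).card : ℝ)}

/-- Coarse scaling distortion `γ`: every pair of distinct vertices that are mutually
`ε/2`-far has distortion at most `γ ε`. -/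
def HasCoarseScalingDistortion (G H : SimpleGraph V) (w : Sym2 V → ℝ) (γ : ℝ → ℝ) : Prop :=
  ∀ ε : ℝ, 0 < ε → ε < 1 → ∀ u v : V, u ≠ v →
    Rgraph G w v (ε / 2) ≤ wdist G w u v → Rgraph G w u (ε / 2) ≤ wdist G w u v →
    wdist H w u v ≤ γ ε * wdist G w u v

end Defs

theorem exists_equiv_antitone {α : Type*} (s : Finset α) (f : α → ℝ) :
    ∃ e : Fin s.card ≃ s, Antitone fun i => f (e i) := by
  refine ⟨(Tuple.sort fun i => -f (s.equivFin.symm i)).trans s.equivFin.symm, fun i j hij => ?_⟩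
  exact neg_le_neg_iff.mp (Tuple.monotone_sort (fun i => -f (s.equivFin.symm i)) hij)

/-- A sequence dominated on each cell of the uniform partition of `[0, 1]` by `g`, whose
first two terms are comparable, has average at most twice the integral of `g` over `[1/M, 1]`. -/
theorem sum_div_le_two_mul_integral {M : ℕ} (hM : 2 ≤ M) (F : ℕ → ℝ) (g : ℝ → ℝ)
    (hg : IntervalIntegrable g MeasureTheory.volume (1 / (M : ℝ)) 1)
    (hg0 : ∀ x ∈ Set.Ioo (0 : ℝ) 1, 0 ≤ g x) (h01 : F 0 ≤ F 1)
    (hF : ∀ i < M, ∀ x : ℝ, 0 < x → x < 1 → x < ((i : ℝ) + 1) / M → F i ≤ g x) :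
    (∑ i ∈ range M, F i) / M ≤ 2 * ∫ x in (1 / (M : ℝ))..1, g x := by
  have hM0 : (0 : ℝ) < M := by positivity
  set a : ℕ → ℝ := fun i => (i : ℝ) / M with ha
  have ha_mono : Monotone a := fun i j hij => by simp only [ha]; gcongr
  have ha1 : a 1 = 1 / M := by simp [ha]
  have haM : a M = 1 := div_self hM0.ne'
  have hsub : ∀ i j, 1 ≤ i → i ≤ j → j ≤ M →
      IntervalIntegrable g MeasureTheory.volume (a i) (a j) := by
    intro i j hi hij hj
    refine hg.mono_set ?_
    rw [← ha1, ← haM, Set.uIcc_of_le (ha_mono hij), Set.uIcc_of_le (ha_mono (by omega))]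
    exact Set.Icc_subset_Icc (ha_mono hi) (ha_mono hj)
  have hcell : ∀ i, 1 ≤ i → i < M → F i / M ≤ ∫ x in a i..a (i + 1), g x := by
    intro i hi hiM
    have hlen : F i / M = ∫ _ in a i..a (i + 1), F i := by
      simp only [intervalIntegral.integral_const, ha, smul_eq_mul]
      push_cast
      ring
    rw [hlen]
    refine intervalIntegral.integral_mono_on_of_le_Ioo (ha_mono (Nat.le_succ i))
      intervalIntegrable_const (hsub i (i + 1) hi (Nat.le_succ i) hiM) fun x hx => ?_
    refine hF i hiM x (lt_of_le_of_lt (by positivity) hx.1)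
      (hx.2.trans_le (haM ▸ ha_mono hiM)) ?_
    simpa [ha] using hx.2
  have htail : (∑ i ∈ Ico 1 M, F i) / M ≤ ∫ x in (1 / (M : ℝ))..1, g x := by
    rw [Finset.sum_div, ← ha1, ← haM, ← intervalIntegral.sum_integral_adjacent_intervals_Ico
      (by omega) fun k hk => hsub k (k + 1) hk.1 (Nat.le_succ k) hk.2]
    exact sum_le_sum fun i hi => hcell i (mem_Ico.mp hi).1 (mem_Ico.mp hi).2
  have hhead : F 0 / M ≤ ∫ x in (1 / (M : ℝ))..1, g x := by
    have hrest : 0 ≤ ∫ x in a 2..a M, g x := by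
      have := intervalIntegral.integral_mono_on_of_le_Ioo (ha_mono hM)
        (intervalIntegrable_const (c := (0 : ℝ))) (hsub 2 M (by omega) hM le_rfl)
        fun x hx => hg0 x ⟨lt_of_le_of_lt (by positivity) hx.1, haM ▸ hx.2⟩
      simpa using this
    rw [← ha1, ← haM, ← intervalIntegral.integral_add_adjacent_intervals
      (hsub 1 2 le_rfl (by omega) hM) (hsub 2 M (by omega) hM le_rfl)]
    have h1 : F 0 / M ≤ F 1 / M := by gcongr
    linarith [hcell 1 le_rfl (by omega)]
  rw [range_eq_Ico, Finset.sum_eq_sum_Ico_succ_bot (by omega), add_div]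
  linarith

section WeightedDistance

variable {V : Type*}

theorem wdist_nonneg {G : SimpleGraph V} {w : Sym2 V → ℝ}
    (hw : ∀ e ∈ G.edgeSet, 0 < w e) (u v : V) : 0 ≤ wdist G w u v := by
  refine Real.sInf_nonneg ?_
  rintro x ⟨p, rfl⟩
  refine List.sum_nonneg fun y hy => ?_
  obtain ⟨e, he, rfl⟩ := List.mem_map.mp hy
  exact (hw e (p.edges_subset_edgeSet he)).le

theorem wdist_comm (G : SimpleGraph V) (w : Sym2 V → ℝ) (u v : V) :
    wdist G w u v = wdist G w v u := by
  have hle : ∀ a b : V, {x : ℝ | ∃ p : G.Walk a b, x = (p.edges.map w).sum} ⊆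
      {x : ℝ | ∃ p : G.Walk b a, x = (p.edges.map w).sum} := by
    rintro a b x ⟨p, rfl⟩
    exact ⟨p.reverse, by simp [SimpleGraph.Walk.edges_reverse]⟩
  exact congrArg sInf ((hle u v).antisymm (hle v u))

end WeightedDistance

/-- If a spanner `H` of a weighted graph `G` on `n ≥ 2` vertices has
scaling distortion `γ` and `x ↦ γ(x)^q` is integrable on `[(1/2)·(n choose 2)⁻¹, 1]`,
then `dist_q(H,G) ≤ (2·∫_{(1/2)(n choose 2)⁻¹}^1 γ(x)^q dx)^{1/q}`. -/
theorem stmt17 {V : Type} [Fintype V] (G H : SimpleGraph V) (w : Sym2 V → ℝ)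
    (hG : IsWeightedGraph G w) (hn : 2 ≤ Fintype.card V)
    (hH : IsSpanner G H) (q : ℝ) (hq : 1 ≤ q)
    (γ : ℝ → ℝ) (hγ0 : ∀ x ∈ Set.Ioc (0 : ℝ) 1, 0 ≤ γ x)
    (hint : IntervalIntegrable (fun x => γ x ^ q) MeasureTheory.volume
      ((1 / 2) * (((Fintype.card V).choose 2 : ℝ))⁻¹) 1)
    (hscal : HasScalingDistortion G H w γ) :
    distq G H w q ≤
      (2 * ∫ x in ((1 / 2) * (((Fintype.card V).choose 2 : ℝ))⁻¹)..1, γ x ^ q) ^ (1 / q) := by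
  have hq0 : 0 < q := by linarith
  have hwH : ∀ e ∈ H.edgeSet, 0 < w e := fun e he =>
    hG.2.1 e (SimpleGraph.edgeSet_mono hH.1 he)
  set r : V × V → ℝ := fun p => wdist H w p.1 p.2 / wdist G w p.1 p.2 with hr
  have hr0 : ∀ p, 0 ≤ r p := fun p =>
    div_nonneg (wdist_nonneg hwH _ _) (wdist_nonneg hG.2.1 _ _)
  have hr_swap : ∀ p, r p.swap = r p := fun p => by
    simp only [hr, Prod.fst_swap, Prod.snd_swap]
    rw [wdist_comm H, wdist_comm G]
  set s : Finset (V × V) := (Finset.univ : Finset V).offDiag with hs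
  obtain ⟨e, he⟩ := exists_equiv_antitone s r
  have hcard : (s.card : ℝ) = (Fintype.card V : ℝ) * ((Fintype.card V : ℝ) - 1) := by
    rw [hs, offDiag_card, Finset.card_univ, Nat.cast_sub (Nat.le_mul_self _)]
    push_cast
    ring
  have hM : 2 ≤ s.card := by
    have hn' : (2 : ℝ) ≤ Fintype.card V := by exact_mod_cast hn
    have : (2 : ℝ) ≤ s.card := by rw [hcard]; nlinarith
    exact_mod_cast this
  have hlow : (1 / 2) * (((Fintype.card V).choose 2 : ℝ))⁻¹ = 1 / (s.card : ℝ) := by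
    rw [hcard, Nat.cast_choose_two, inv_div]
    ring
  have hrank : ∀ i : Fin s.card, ∀ x : ℝ, 0 < x → x < 1 → x < ((i : ℝ) + 1) / s.card →
      r (e i) ≤ γ x := by
    intro i x hx0 hx1 hxi
    by_contra! hbad
    have hgood := hscal x hx0 hx1
    rw [← hcard] at hgood
    set B : Finset (V × V) := (Finset.Iic i).image fun k => (e k : V × V)
    have hBcard : B.card = i + 1 := by
      have hinj : Function.Injective fun k => (e k : V × V) :=
        Subtype.val_injective.comp e.injective
      rw [Finset.card_image_of_injective _ hinj, Fin.card_Iic]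
    have hdisj : Disjoint (goodPairs G H w (γ x)) B := by
      rw [Finset.disjoint_left]
      intro p hp hpB
      obtain ⟨k, hk, rfl⟩ := Finset.mem_image.mp hpB
      have hle : r (e k) ≤ γ x := div_le_of_le_mul₀ (wdist_nonneg hG.2.1 _ _)
        (hγ0 x ⟨hx0, hx1.le⟩) (Finset.mem_filter.mp hp).2
      exact absurd (he (Finset.mem_Iic.mp hk)) (by simpa using hle.trans_lt hbad)
    have hsub : goodPairs G H w (γ x) ∪ B ⊆ s := by
      refine Finset.union_subset (Finset.filter_subset _ _) fun p hp => ?_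
      obtain ⟨k, -, rfl⟩ := Finset.mem_image.mp hp
      exact (e k).2
    have hcount := Finset.card_le_card hsub
    rw [Finset.card_union_of_disjoint hdisj, hBcard] at hcount
    have hcount' : ((goodPairs G H w (γ x)).card : ℝ) + (i + 1) ≤ s.card := by
      exact_mod_cast hcount
    rw [lt_div_iff₀ (by positivity)] at hxi
    linarith
  set F : ℕ → ℝ := fun i => if h : i < s.card then r (e ⟨i, h⟩) ^ q else 0 with hF
  have hsum : ∑ p ∈ s, r p ^ q = ∑ i ∈ range s.card, F i := by
    rw [← Fin.sum_univ_eq_sum_range, ← Finset.sum_coe_sort, ← e.sum_comp]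
    simp [hF]
  have h01 : F 0 ≤ F 1 := by
    have h0 : 0 < s.card := by omega
    have h1 : 1 < s.card := by omega
    simp only [hF, h0, h1, dif_pos]
    refine Real.rpow_le_rpow (hr0 _) ?_ hq0.le
    set p := e ⟨0, h0⟩ with hp
    have hpne : (p : V × V).1 ≠ (p : V × V).2 := (mem_offDiag.mp p.2).2.2
    have hmem : (p : V × V).swap ∈ s := by simpa [hs] using hpne.symm
    set k := e.symm ⟨_, hmem⟩ with hk
    have hek : (e k : V × V) = (p : V × V).swap := by simp [hk]
    have hk0 : (1 : ℕ) ≤ k := by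
      by_contra! h
      have hk' : k = ⟨0, h0⟩ := Fin.ext (by simpa using h)
      rw [hk', ← hp] at hek
      exact hpne (congrArg Prod.fst hek)
    calc r p = r (e k) := by rw [hek, hr_swap]
      _ ≤ r (e ⟨1, h1⟩) := he (Fin.mk_le_of_le_val hk0)
  rw [hlow] at hint ⊢
  refine Real.rpow_le_rpow (div_nonneg (Finset.sum_nonneg fun p _ => Real.rpow_nonneg (hr0 p) q)
    (hcard ▸ Nat.cast_nonneg _)) ?_ (by positivity)
  rw [← hcard]
  change (∑ p ∈ s, r p ^ q) / _ ≤ _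
  rw [hsum]
  refine sum_div_le_two_mul_integral hM F _ hint
    (fun x hx => Real.rpow_nonneg (hγ0 x ⟨hx.1, hx.2.le⟩) q) h01 fun i hi x hx0 hx1 hxi => ?_
  simp only [hF, hi, dif_pos]
  exact Real.rpow_le_rpow (hr0 _) (hrank ⟨i, hi⟩ x hx0 hx1 hxi) hq0.le
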